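/- arXiv:2004.09079 — 2 statements merged into one kernel-verified Lean document; each statement's English description precedes it below -/
import Mathlib

section
/- Let μ be a probability distribution on the k-element subsets of [n] whose generating polynomial g_μ is log-concave. Then for every subset T ⊆ [n], P_{S∼μ}[S ⊆ T] ≤ ((1/k) · ∑_{i∈T} P_{S∼μ}[i ∈ S])^k, where P_{S∼μ}[S ⊆ T] = ∑_{S ⊆ T} μ(S). -/
open Finset

/-- A probability distribution on the `k`-element subsets of `[n]`:
nonnegative, supported on `k`-element sets, summing to `1`. -/
def IsProbDistOn (n k : ℕ) (μ : Finset (Fin n) → ℝ) : Prop :=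
  (∀ S, 0 ≤ μ S) ∧ (∀ S, S.card ≠ k → μ S = 0) ∧ (∑ S : Finset (Fin n), μ S = 1)

/-- The generating polynomial `g_μ(z) = ∑_{|S|=k} μ(S) ∏_{i∈S} z_i`. -/
noncomputable def genPoly (n k : ℕ) (μ : Finset (Fin n) → ℝ) (z : Fin n → ℝ) : ℝ :=
  ∑ S ∈ Finset.univ.filter (fun S : Finset (Fin n) => S.card = k), μ S * ∏ i ∈ S, z i

/-- `g` is log-concave as a function on `ℝ_{≥0}^n`. -/
def IsLogConcaveOn (n : ℕ) (g : (Fin n → ℝ) → ℝ) : Prop :=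
  ∀ x y : Fin n → ℝ, (∀ i, 0 ≤ x i) → (∀ i, 0 ≤ y i) →
    ∀ lam : ℝ, 0 < lam → lam < 1 →
      g x ^ lam * g y ^ (1 - lam) ≤ g (fun i => lam * x i + (1 - lam) * y i)

/-- The marginal `P_{S∼μ}[i ∈ S]`. -/
noncomputable def marginal (n : ℕ) (μ : Finset (Fin n) → ℝ) (i : Fin n) : ℝ :=
  ∑ S ∈ Finset.univ.filter (fun S : Finset (Fin n) => i ∈ S), μ S

theorem genPoly_const_mul (n k : ℕ) (μ : Finset (Fin n) → ℝ) (c : ℝ) (z : Fin n → ℝ) :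
    genPoly n k μ (fun i => c * z i) = c ^ k * genPoly n k μ z := by
  unfold genPoly
  rw [mul_sum]
  refine sum_congr rfl fun S hS => ?_
  rw [prod_mul_distrib, prod_const, (mem_filter.mp hS).2]
  ring

theorem IsProbDistOn.genPoly_eq_sum {n k : ℕ} {μ : Finset (Fin n) → ℝ}
    (hμ : IsProbDistOn n k μ) (z : Fin n → ℝ) :
    genPoly n k μ z = ∑ S, μ S * ∏ i ∈ S, z i := by
  refine sum_subset (subset_univ _) fun S _ hS => ?_
  rw [hμ.2.1 S (by simpa using hS), zero_mul]

theorem IsProbDistOn.genPoly_one {n k : ℕ} {μ : Finset (Fin n) → ℝ}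
    (hμ : IsProbDistOn n k μ) : genPoly n k μ (fun _ => 1) = 1 := by
  simp [hμ.genPoly_eq_sum, hμ.2.2]

theorem IsProbDistOn.genPoly_indicator {n k : ℕ} {μ : Finset (Fin n) → ℝ}
    (hμ : IsProbDistOn n k μ) (T : Finset (Fin n)) :
    genPoly n k μ (fun i => if i ∈ T then 1 else 0) = ∑ S with S ⊆ T, μ S := by
  rw [hμ.genPoly_eq_sum, sum_filter]
  refine sum_congr rfl fun S _ => ?_
  rw [prod_ite_zero, prod_const_one, mul_ite, mul_one, mul_zero]
  rfl

theorem sum_mul_marginal {n : ℕ} {μ : Finset (Fin n) → ℝ}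
    (x : Fin n → ℝ) :
    ∑ i, x i * marginal n μ i = ∑ S, μ S * ∑ i ∈ S, x i := by
  simp only [marginal, sum_filter, mul_sum]
  rw [sum_comm]
  refine sum_congr rfl fun S _ => ?_
  simp [mul_comm]

theorem IsProbDistOn.hasDerivAt_genPoly_segment {n k : ℕ} {μ : Finset (Fin n) → ℝ}
    (hμ : IsProbDistOn n k μ) (x : Fin n → ℝ) :
    HasDerivAt (fun t => genPoly n k μ (fun i => t * x i + (1 - t) * 1))
      (∑ i, x i * marginal n μ i - k) 0 := by
  have hlin (i : Fin n) : HasDerivAt (fun t : ℝ => t * x i + (1 - t) * 1) (x i - 1) 0 := by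
    have h := ((hasDerivAt_id (0 : ℝ)).mul_const (x i)).add
      (((hasDerivAt_id (0 : ℝ)).const_sub 1).mul_const 1)
    exact h.congr_deriv (by ring)
  have hS (S : Finset (Fin n)) := (HasDerivAt.fun_finsetProd (u := S)
    fun i _ => hlin i).const_mul (μ S)
  simp only [hμ.genPoly_eq_sum]
  refine (HasDerivAt.fun_sum (u := univ) fun S _ => hS S).congr_deriv ?_
  have hk : (k : ℝ) = ∑ S, μ S * k := by rw [← sum_mul, hμ.2.2, one_mul]
  rw [hk, sum_mul_marginal, ← sum_sub_distrib]
  refine sum_congr rfl fun S _ => ?_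
  by_cases hc : S.card = k
  · simp [sum_sub_distrib, hc, mul_sub]
  · simp [hμ.2.1 S hc]

theorem HasDerivAt.nonneg_of_right_min {f : ℝ → ℝ} {f' : ℝ} (hf : HasDerivAt f f' 0)
    (h : ∀ t, 0 < t → t < 1 → f 0 ≤ f t) : 0 ≤ f' := by
  have hs := (hasDerivWithinAt_iff_tendsto_slope' (s := Set.Ioi (0 : ℝ)) (by simp)).mp
    hf.hasDerivWithinAt
  refine ge_of_tendsto hs ?_
  filter_upwards [Ioo_mem_nhdsGT (zero_lt_one' ℝ)] with t ht
  rw [slope_def_field]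
  exact div_nonneg (sub_nonneg.mpr (h t ht.1 ht.2)) (by linarith [ht.1])

theorem subset_probability_bound
    (n k : ℕ) (hk : 1 ≤ k) (hkn : k ≤ n)
    (μ : Finset (Fin n) → ℝ) (hμ : IsProbDistOn n k μ)
    (hlc : IsLogConcaveOn n (genPoly n k μ))
    (T : Finset (Fin n)) :
    (∑ S ∈ Finset.univ.filter (fun S : Finset (Fin n) => S ⊆ T), μ S)
      ≤ ((1 / (k : ℝ)) * ∑ i ∈ T, marginal n μ i) ^ k := by
  have hk0 : k ≠ 0 := by lia
  have hm : 0 ≤ (1 / (k : ℝ)) * ∑ i ∈ T, marginal n μ i :=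
    mul_nonneg (by positivity) (sum_nonneg fun i _ => sum_nonneg fun S _ => hμ.1 S)
  rcases (sum_nonneg fun S _ => hμ.1 S :
    0 ≤ ∑ S ∈ univ.filter (fun S : Finset (Fin n) => S ⊆ T), μ S).eq_or_lt with hp | hp
  · rw [← hp]
    positivity
  set p := ∑ S ∈ univ.filter (fun S : Finset (Fin n) => S ⊆ T), μ S with hp_def
  obtain ⟨r, hr, hrp⟩ : ∃ r : ℝ, 0 < r ∧ r ^ k = p :=
    ⟨p ^ (k⁻¹ : ℝ), by positivity, Real.rpow_inv_natCast_pow hp.le hk0⟩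
  let x : Fin n → ℝ := fun i => r⁻¹ * if i ∈ T then 1 else 0
  have hx : ∀ i, 0 ≤ x i := fun i => by dsimp only [x]; split_ifs <;> positivity
  have hgx : genPoly n k μ x = 1 := by
    rw [genPoly_const_mul, hμ.genPoly_indicator, ← hp_def, ← hrp, ← mul_pow,
      inv_mul_cancel₀ hr.ne', one_pow]
  have hderiv := (hμ.hasDerivAt_genPoly_segment x).nonneg_of_right_min fun t ht0 ht1 => by
    have h := hlc x (fun _ => 1) hx (fun _ => zero_le_one) t ht0 ht1
    simpa [hgx, hμ.genPoly_one] using h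
  have hsum : ∑ i, x i * marginal n μ i = r⁻¹ * ∑ i ∈ T, marginal n μ i := by
    simp [x, ← mul_sum]
  rw [← hrp]
  refine pow_le_pow_left₀ hr.le ?_ k
  have hkr : (k : ℝ) ≤ r⁻¹ * ∑ i ∈ T, marginal n μ i := by linarith
  have hkpos : (0 : ℝ) < k := by positivity
  rw [one_div, le_inv_mul_iff₀ hkpos]
  rwa [le_inv_mul_iff₀ hr, mul_comm] at hkr
end

section
/- Let μ be a probability distribution on the k-element subsets of [n] whose generating polynomial g_μ is log-concave, and let ν be any probability distribution on the k-element subsets of [n] with supp ν ⊆ supp μ. Then for every integer l with 1 ≤ l ≤ k, D(ν D_{k→l} ‖ μ D_{k→l}) ≤ (l/k) · D(ν ‖ μ). -/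
open Finset

/-- The down operator `D_{k→l}` applied to a distribution on `k`-subsets:
`μD_{k→l}(T) = (1/binom(k,l)) ∑_{S ⊇ T, |S|=k} μ(S)` for `|T| = l`, and `0` otherwise. -/
noncomputable def downOp (n k l : ℕ) (μ : Finset (Fin n) → ℝ) (T : Finset (Fin n)) : ℝ :=
  if T.card = l then
    (1 / (k.choose l : ℝ)) *
      ∑ S ∈ Finset.univ.filter (fun S : Finset (Fin n) => S.card = k ∧ T ⊆ S), μ S
  else 0

/-- KL divergence between two densities on subsets of `[n]`, with the convention
that terms with `ν S = 0` contribute `0`. -/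
noncomputable def klDiv (n : ℕ) (ν μ : Finset (Fin n) → ℝ) : ℝ :=
  ∑ S : Finset (Fin n), if ν S = 0 then 0 else ν S * Real.log (ν S / μ S)

/-- The total mass that `ν` gives to the supersets of `T`. -/
noncomputable def upMass (n : ℕ) (ν : Finset (Fin n) → ℝ) (T : Finset (Fin n)) : ℝ :=
  ∑ S ∈ univ.filter (fun S : Finset (Fin n) => T ⊆ S), ν S

/-- The iterated derivative `∂_T g_μ` of the generating polynomial. -/
noncomputable def linkPoly (n : ℕ) (μ : Finset (Fin n) → ℝ) (T : Finset (Fin n))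
    (z : Fin n → ℝ) : ℝ :=
  ∑ S ∈ univ.filter (fun S : Finset (Fin n) => T ⊆ S), μ S * ∏ i ∈ S \ T, z i

section LinkPoly

variable {n k : ℕ} {μ : Finset (Fin n) → ℝ}

lemma linkPoly_one (T : Finset (Fin n)) : linkPoly n μ T (fun _ => 1) = upMass n μ T := by
  simp [linkPoly, upMass]

lemma linkPoly_nonneg (h0 : ∀ S, 0 ≤ μ S) (T : Finset (Fin n)) {z : Fin n → ℝ}
    (hz : ∀ i, 0 ≤ z i) : 0 ≤ linkPoly n μ T z :=
  sum_nonneg fun S _ => mul_nonneg (h0 S) (prod_nonneg fun i _ => hz i)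

lemma genPoly_nonneg (h0 : ∀ S, 0 ≤ μ S) {z : Fin n → ℝ}
    (hz : ∀ i, 0 ≤ z i) : 0 ≤ genPoly n k μ z :=
  sum_nonneg fun S _ => mul_nonneg (h0 S) (prod_nonneg fun i _ => hz i)

/-- Blowing up the coordinates in `T` and rescaling. -/
lemma pow_mul_genPoly_ite (hk : ∀ S, S.card ≠ k → μ S = 0) (T : Finset (Fin n))
    (x : Fin n → ℝ) {s : ℝ} (hs : 0 < s) :
    s ^ T.card * genPoly n k μ (fun i => if i ∈ T then s⁻¹ else x i)
      = ∑ S, μ S * (s ^ (T \ S).card * ∏ i ∈ S \ T, x i) := by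
  unfold genPoly
  rw [sum_filter_of_ne (fun S _ hS => by
    by_contra hc
    exact hS (by rw [hk S hc, zero_mul])), mul_sum]
  refine sum_congr rfl fun S _ => ?_
  have h1 : ∏ i ∈ S, (if i ∈ T then s⁻¹ else x i) = s⁻¹ ^ (S ∩ T).card * ∏ i ∈ S \ T, x i := by
    rw [prod_ite, prod_const, filter_mem_eq_inter, ← sdiff_eq_filter]
  have h2 : T.card = (T \ S).card + (S ∩ T).card := by
    rw [inter_comm, card_sdiff_add_card_inter]
  rw [h1, h2, pow_add, inv_pow]
  have : s ^ (S ∩ T).card ≠ 0 := by positivity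
  field_simp

lemma tendsto_pow_mul_genPoly_ite (hk : ∀ S, S.card ≠ k → μ S = 0) (T : Finset (Fin n))
    (x : Fin n → ℝ) :
    Filter.Tendsto
      (fun s : ℝ => s ^ T.card * genPoly n k μ (fun i => if i ∈ T then s⁻¹ else x i))
      (nhdsWithin 0 (Set.Ioi 0)) (nhds (linkPoly n μ T x)) := by
  have hc : Continuous fun s : ℝ => ∑ S, μ S * (s ^ (T \ S).card * ∏ i ∈ S \ T, x i) := by
    fun_prop
  have h0 : ∑ S, μ S * ((0 : ℝ) ^ (T \ S).card * ∏ i ∈ S \ T, x i) = linkPoly n μ T x := by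
    rw [linkPoly, sum_filter]
    refine sum_congr rfl fun S _ => ?_
    split_ifs with h
    · simp [sdiff_eq_empty_iff_subset.2 h]
    · have : (T \ S).card ≠ 0 := by
        rwa [Ne, card_eq_zero, sdiff_eq_empty_iff_subset]
      simp [zero_pow this]
  have ht := (hc.tendsto 0).mono_left (nhdsWithin_le_nhds (s := Set.Ioi 0))
  rw [h0] at ht
  refine ht.congr' ?_
  filter_upwards [self_mem_nhdsWithin] with s hs
  exact (pow_mul_genPoly_ite hk T x hs).symm

lemma isLogConcaveOn_linkPoly (h0 : ∀ S, 0 ≤ μ S) (hk : ∀ S, S.card ≠ k → μ S = 0)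
    (hlc : IsLogConcaveOn n (genPoly n k μ)) (T : Finset (Fin n)) :
    IsLogConcaveOn n (linkPoly n μ T) := by
  intro x y hx hy lam hl0 hl1
  have hl1' : 0 < 1 - lam := sub_pos.2 hl1
  refine le_of_tendsto_of_tendsto
    (((tendsto_pow_mul_genPoly_ite hk T x).rpow_const (Or.inr hl0.le)).mul
      ((tendsto_pow_mul_genPoly_ite hk T y).rpow_const (Or.inr hl1'.le)))
    (tendsto_pow_mul_genPoly_ite hk T _) ?_
  filter_upwards [self_mem_nhdsWithin] with s hs
  have hs : 0 < s := hs
  have hpos : ∀ z : Fin n → ℝ, (∀ i, 0 ≤ z i) → ∀ i, 0 ≤ if i ∈ T then s⁻¹ else z i := by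
    intro z hz i
    split_ifs
    · positivity
    · exact hz i
  have key := hlc _ _ (hpos x hx) (hpos y hy) lam hl0 hl1
  have hp : 0 < s ^ T.card := by positivity
  rw [Real.mul_rpow hp.le (genPoly_nonneg h0 (hpos x hx)),
    Real.mul_rpow hp.le (genPoly_nonneg h0 (hpos y hy)), mul_mul_mul_comm, ← Real.rpow_add hp,
    add_sub_cancel, Real.rpow_one]
  refine mul_le_mul_of_nonneg_left (key.trans_eq ?_) hp.le
  congr 1
  funext i
  split_ifs <;> ring

lemma sum_upMass_insert_mul (ν : Finset (Fin n) → ℝ) (T : Finset (Fin n)) (w : Fin n → ℝ) :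
    ∑ i ∈ Tᶜ, upMass n ν (insert i T) * w i
      = ∑ S ∈ univ.filter (fun S => T ⊆ S), ν S * ∑ i ∈ S \ T, w i := by
  simp only [upMass, sum_mul, mul_sum]
  refine sum_comm' fun i S => ?_
  simp only [mem_compl, mem_filter, mem_univ, true_and, mem_sdiff, insert_subset_iff]
  tauto

lemma sum_upMass_insert {ν : Finset (Fin n) → ℝ} (hk : ∀ S, S.card ≠ k → ν S = 0)
    (T : Finset (Fin n)) :
    ∑ i ∈ Tᶜ, upMass n ν (insert i T) = ((k : ℝ) - T.card) * upMass n ν T := by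
  have h := sum_upMass_insert_mul ν T (fun _ => 1)
  simp only [mul_one, sum_const, nsmul_eq_mul] at h
  rw [h, upMass, mul_sum]
  refine sum_congr rfl fun S hS => ?_
  by_cases hc : S.card = k
  · rw [cast_card_sdiff (mem_filter.1 hS).2, hc, mul_comm]
  · simp [hk S hc]

lemma hasDerivAt_linkPoly_segment (T : Finset (Fin n)) (z : Fin n → ℝ) :
    HasDerivAt (fun t : ℝ => linkPoly n μ T (fun i => t * z i + (1 - t) * 1))
      (∑ i ∈ Tᶜ, upMass n μ (insert i T) * (z i - 1)) 0 := by
  rw [sum_upMass_insert_mul]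
  unfold linkPoly
  refine HasDerivAt.fun_sum fun S _ => HasDerivAt.const_mul _ ?_
  have h : ∀ i ∈ S \ T, HasDerivAt (fun t : ℝ => t * z i + (1 - t) * 1) (z i - 1) 0 := by
    intro i _
    have h1 := ((hasDerivAt_id (0 : ℝ)).mul_const (z i - 1)).add_const 1
    rw [one_mul] at h1
    refine h1.congr_of_eventuallyEq (Filter.Eventually.of_forall fun t => ?_)
    simp only [id]
    ring
  have h2 := HasDerivAt.fun_finsetProd h
  simpa using h2

/-- The tangent-plane inequality for a log-concave link at the all-ones point. -/
lemma linkPoly_le_upMass {T : Finset (Fin n)}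
    (hlc : IsLogConcaveOn n (linkPoly n μ T)) (hM : 0 < upMass n μ T) {z : Fin n → ℝ}
    (hz : ∀ i, 0 ≤ z i) (hle : ∑ i ∈ Tᶜ, upMass n μ (insert i T) * (z i - 1) ≤ 0) :
    linkPoly n μ T z ≤ upMass n μ T := by
  by_contra! hlt
  have hF : 0 < linkPoly n μ T z := hM.trans hlt
  have hc : 0 < Real.log (linkPoly n μ T z / upMass n μ T) :=
    Real.log_pos ((one_lt_div hM).2 hlt)
  set c := Real.log (linkPoly n μ T z / upMass n μ T) with hcdef
  have hd := (hasDerivAt_linkPoly_segment (μ := μ) T z).tendsto_slope_zero_right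
  have hge : upMass n μ T * c ≤ ∑ i ∈ Tᶜ, upMass n μ (insert i T) * (z i - 1) := by
    refine ge_of_tendsto hd ?_
    filter_upwards [Ioo_mem_nhdsGT (zero_lt_one' ℝ)] with t ht
    have h1 := hlc z (fun _ => 1) hz (fun _ => zero_le_one) t ht.1 ht.2
    have h2 : linkPoly n μ T z ^ t * linkPoly n μ T (fun _ => 1) ^ (1 - t)
        = upMass n μ T * Real.exp (c * t) := by
      rw [linkPoly_one, Real.rpow_sub hM, Real.rpow_one, mul_comm c, hcdef, mul_comm t,
        ← Real.rpow_def_of_pos (div_pos hF hM), Real.div_rpow hF.le hM.le]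
      ring
    rw [h2] at h1
    have h3 : upMass n μ T * (c * t + 1) ≤ upMass n μ T * Real.exp (c * t) :=
      mul_le_mul_of_nonneg_left (Real.add_one_le_exp _) hM.le
    have h4 : linkPoly n μ T (fun i => 0 * z i + (1 - 0) * 1) = upMass n μ T := by
      rw [← linkPoly_one]
      congr 1
      funext i
      ring
    rw [zero_add, h4, smul_eq_mul, inv_mul_eq_div, le_div_iff₀ ht.1]
    linarith
  have := mul_pos hM hc
  linarith

end LinkPoly

section UpMass

variable {n k : ℕ} {ν : Finset (Fin n) → ℝ}

lemma upMass_nonneg (h0 : ∀ S, 0 ≤ ν S) (T : Finset (Fin n)) : 0 ≤ upMass n ν T :=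
  sum_nonneg fun S _ => h0 S

lemma upMass_mono (h0 : ∀ S, 0 ≤ ν S) {T U : Finset (Fin n)} (h : T ⊆ U) :
    upMass n ν U ≤ upMass n ν T :=
  sum_le_sum_of_subset_of_nonneg
    (fun _ hS => mem_filter.2 ⟨mem_univ _, h.trans (mem_filter.1 hS).2⟩) fun S _ _ => h0 S

lemma le_upMass (h0 : ∀ S, 0 ≤ ν S) {T S : Finset (Fin n)} (h : T ⊆ S) : ν S ≤ upMass n ν T :=
  single_le_sum (f := ν) (fun S _ => h0 S) (mem_filter.2 ⟨mem_univ _, h⟩)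

lemma upMass_eq_self (hk : ∀ S, S.card ≠ k → ν S = 0) {T : Finset (Fin n)} (hT : T.card = k) :
    upMass n ν T = ν T := by
  refine sum_eq_single_of_mem T (by simp) fun S hS hne => hk S fun hc => hne ?_
  exact (eq_of_subset_of_card_le (mem_filter.1 hS).2 (hc.trans hT.symm).le).symm

lemma upMass_eq_zero {μ : Finset (Fin n) → ℝ} (h0 : ∀ S, 0 ≤ μ S)
    (hsupp : ∀ S, μ S = 0 → ν S = 0) {T : Finset (Fin n)} (hT : upMass n μ T = 0) :
    upMass n ν T = 0 :=
  sum_eq_zero fun S hS => hsupp S ((sum_eq_zero_iff_of_nonneg fun _ _ => h0 _).1 hT S hS)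

lemma downOp_eq (hk : ∀ S, S.card ≠ k → ν S = 0) (l : ℕ) (T : Finset (Fin n)) :
    downOp n k l ν T = if T.card = l then (1 / (k.choose l : ℝ)) * upMass n ν T else 0 := by
  unfold downOp upMass
  congr 2
  rw [← filter_filter, filter_comm, sum_filter_of_ne]
  intro S _ hS
  by_contra hc
  exact hS (hk S hc)

end UpMass

/-- Unnormalized KL divergence at level `m`. -/
noncomputable def levelEnt (n : ℕ) (ν μ : Finset (Fin n) → ℝ) (m : ℕ) : ℝ :=
  ∑ T ∈ powersetCard m univ, upMass n ν T * Real.log (upMass n ν T / upMass n μ T)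

section Contraction

variable {n k : ℕ} {μ ν : Finset (Fin n) → ℝ}

/-- Entropic independence of the link of `T`. -/
lemma sum_upMass_insert_mul_log_le (hμ0 : ∀ S, 0 ≤ μ S) (hμk : ∀ S, S.card ≠ k → μ S = 0)
    (hlc : IsLogConcaveOn n (genPoly n k μ)) (hν0 : ∀ S, 0 ≤ ν S)
    (hνk : ∀ S, S.card ≠ k → ν S = 0) (hsupp : ∀ S, μ S = 0 → ν S = 0) (T : Finset (Fin n)) :
    ∑ i ∈ Tᶜ, upMass n ν (insert i T)
        * Real.log (upMass n ν (insert i T) / upMass n μ (insert i T))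
      ≤ ∑ S ∈ univ.filter (fun S => T ⊆ S), ν S * Real.log (ν S / μ S)
        + ((k : ℝ) - T.card - 1) * (upMass n ν T * Real.log (upMass n ν T / upMass n μ T)) := by
  rcases (upMass_nonneg hν0 T).eq_or_lt with hN | hN
  · have h1 : ∀ i ∈ Tᶜ, upMass n ν (insert i T)
        * Real.log (upMass n ν (insert i T) / upMass n μ (insert i T)) = 0 := by
      intro i _
      have := (upMass_mono hν0 (subset_insert i T)).trans hN.ge
      rw [le_antisymm this (upMass_nonneg hν0 _), zero_mul]
    have h2 : ∀ S ∈ univ.filter (fun S => T ⊆ S), ν S * Real.log (ν S / μ S) = 0 := by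
      intro S hS
      have := (le_upMass hν0 (mem_filter.1 hS).2).trans hN.ge
      rw [le_antisymm this (hν0 _), zero_mul]
    rw [sum_eq_zero h1, sum_eq_zero h2, ← hN]
    simp
  have hM : 0 < upMass n μ T :=
    (upMass_nonneg hμ0 T).lt_of_ne fun h => hN.ne' (upMass_eq_zero hμ0 hsupp h.symm)
  set N := upMass n ν T with hNdef
  set M := upMass n μ T with hMdef
  have hNM : 0 < N / M := div_pos hN hM
  set z : Fin n → ℝ := fun i =>
    (upMass n ν (insert i T) / upMass n μ (insert i T)) / (N / M) with hzdef
  have hz : ∀ i, 0 ≤ z i := fun i =>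
    div_nonneg (div_nonneg (upMass_nonneg hν0 _) (upMass_nonneg hμ0 _)) (by positivity)
  have hpz : ∀ i, upMass n μ (insert i T) * z i = upMass n ν (insert i T) * (M / N) := by
    intro i
    by_cases hp : upMass n μ (insert i T) = 0
    · rw [hp, upMass_eq_zero hμ0 hsupp hp, zero_mul, zero_mul]
    · simp only [hzdef]
      field_simp
  have hle : linkPoly n μ T z ≤ M := by
    refine linkPoly_le_upMass (isLogConcaveOn_linkPoly hμ0 hμk hlc T) hM hz (le_of_eq ?_)
    simp only [mul_sub, mul_one, sum_sub_distrib, hpz, ← sum_mul]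
    rw [sum_upMass_insert hνk, sum_upMass_insert hμk, ← hNdef, ← hMdef]
    field_simp
    ring
  have hlog : ∀ i ∈ Tᶜ, upMass n ν (insert i T) * Real.log (z i)
      = upMass n ν (insert i T)
          * Real.log (upMass n ν (insert i T) / upMass n μ (insert i T))
        - upMass n ν (insert i T) * Real.log (N / M) := by
    intro i _
    by_cases hq : upMass n ν (insert i T) = 0
    · simp [hq]
    · have hp : upMass n μ (insert i T) ≠ 0 := fun h => hq (upMass_eq_zero hμ0 hsupp h)
      rw [hzdef, Real.log_div (div_ne_zero hq hp) (by positivity), mul_sub]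
  have hpoint : ∀ S ∈ univ.filter (fun S => T ⊆ S),
      ν S - N / M * (μ S * ∏ i ∈ S \ T, z i)
        ≤ ν S * Real.log (ν S / μ S) - ν S * Real.log (N / M)
          - ν S * ∑ i ∈ S \ T, Real.log (z i) := by
    intro S hS
    have hTS : T ⊆ S := (mem_filter.1 hS).2
    rcases (hν0 S).eq_or_lt with h | h
    · have h1 : 0 ≤ N / M * (μ S * ∏ i ∈ S \ T, z i) :=
        mul_nonneg (by positivity) (mul_nonneg (hμ0 S) (prod_nonneg fun i _ => hz i))
      rw [← h]
      simpa using h1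
    have hμS : 0 < μ S := (hμ0 S).lt_of_ne fun h' => h.ne' (hsupp S h'.symm)
    have hzpos : ∀ i ∈ S \ T, 0 < z i := by
      intro i hi
      have hsub : insert i T ⊆ S := insert_subset (mem_sdiff.1 hi).1 hTS
      exact div_pos (div_pos (h.trans_le (le_upMass hν0 hsub))
        (hμS.trans_le (le_upMass hμ0 hsub))) (by positivity)
    have hprod : 0 < ∏ i ∈ S \ T, z i := prod_pos hzpos
    have hlogsplit : Real.log (ν S / μ S / (N / M) / ∏ i ∈ S \ T, z i)
        = Real.log (ν S / μ S) - Real.log (N / M) - ∑ i ∈ S \ T, Real.log (z i) := by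
      rw [Real.log_div (div_pos (div_pos h hμS) hNM).ne' hprod.ne',
        Real.log_div (div_pos h hμS).ne' hNM.ne', Real.log_prod fun i hi => (hzpos i hi).ne']
    have h1 := mul_le_mul_of_nonneg_left (Real.one_sub_inv_le_log_of_pos
      (div_pos (div_pos (div_pos h hμS) hNM) hprod)) h.le
    rw [hlogsplit] at h1
    calc _ = ν S * (1 - (ν S / μ S / (N / M) / ∏ i ∈ S \ T, z i)⁻¹) := by
          generalize ∏ i ∈ S \ T, z i = P
          rw [inv_div, div_div_eq_mul_div, div_div_eq_mul_div, mul_sub, mul_one,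
            mul_div_cancel₀ _ h.ne']
          ring
      _ ≤ _ := h1
      _ = _ := by ring
  have hsum := sum_le_sum hpoint
  simp only [sum_sub_distrib, ← mul_sum, ← sum_mul] at hsum
  rw [← sum_upMass_insert_mul ν T fun i => Real.log (z i), sum_congr rfl hlog, sum_sub_distrib,
    ← sum_mul, sum_upMass_insert hνk] at hsum
  change N - N / M * linkPoly n μ T z ≤ _ - N * _ - _ at hsum
  have h1 : N / M * linkPoly n μ T z ≤ N / M * M :=
    mul_le_mul_of_nonneg_left hle (by positivity)
  rw [div_mul_cancel₀ _ hM.ne'] at h1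
  linarith

lemma sum_powersetCard_sum_insert (f : Finset (Fin n) → ℝ) (m : ℕ) :
    ∑ T ∈ powersetCard m univ, ∑ i ∈ Tᶜ, f (insert i T)
      = (m + 1 : ℝ) * ∑ U ∈ powersetCard (m + 1) univ, f U := by
  have h : ∑ U ∈ powersetCard (m + 1) univ, ∑ _i ∈ U, f U
      = (m + 1 : ℝ) * ∑ U ∈ powersetCard (m + 1) univ, f U := by
    rw [mul_sum]
    refine sum_congr rfl fun U hU => ?_
    rw [sum_const, (mem_powersetCard.1 hU).2, nsmul_eq_mul]
    push_cast
    rfl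
  rw [← h, sum_sigma', sum_sigma']
  refine sum_bij' (fun p _ => ⟨insert p.2 p.1, p.2⟩) (fun p _ => ⟨p.1.erase p.2, p.2⟩)
    ?_ ?_ ?_ ?_ ?_
  · rintro ⟨T, i⟩ hp
    simp only [mem_sigma, mem_powersetCard, subset_univ, true_and, mem_compl] at hp ⊢
    exact ⟨by rw [card_insert_of_notMem hp.2, hp.1], mem_insert_self _ _⟩
  · rintro ⟨U, i⟩ hp
    simp only [mem_sigma, mem_powersetCard, subset_univ, true_and, mem_compl] at hp ⊢
    exact ⟨by rw [card_erase_of_mem hp.2, hp.1, Nat.add_sub_cancel], notMem_erase _ _⟩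
  · rintro ⟨T, i⟩ hp
    simp only [mem_sigma, mem_compl] at hp
    simp [erase_insert hp.2]
  · rintro ⟨U, i⟩ hp
    simp only [mem_sigma] at hp
    simp [insert_erase hp.2]
  · intro p _
    rfl

lemma sum_powersetCard_sum_superset {f : Finset (Fin n) → ℝ} (hf : ∀ S, S.card ≠ k → f S = 0)
    (m : ℕ) :
    ∑ T ∈ powersetCard m univ, ∑ S ∈ univ.filter (fun S => T ⊆ S), f S
      = (k.choose m : ℝ) * ∑ S, f S := by
  rw [sum_comm' (t' := univ) (s' := fun S => powersetCard m S) (fun T S => by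
    simp only [mem_powersetCard, subset_univ, true_and, mem_filter, mem_univ, and_true]
    tauto), mul_sum]
  refine sum_congr rfl fun S _ => ?_
  rw [sum_const, card_powersetCard, nsmul_eq_mul]
  by_cases h : S.card = k
  · rw [h]
  · simp [hf S h]

lemma klDiv_eq_sum : klDiv n ν μ = ∑ S, ν S * Real.log (ν S / μ S) := by
  refine sum_congr rfl fun S _ => ?_
  split_ifs with h
  · rw [h, zero_mul]
  · rfl

lemma levelEnt_step (hμ0 : ∀ S, 0 ≤ μ S) (hμk : ∀ S, S.card ≠ k → μ S = 0)
    (hlc : IsLogConcaveOn n (genPoly n k μ)) (hν0 : ∀ S, 0 ≤ ν S)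
    (hνk : ∀ S, S.card ≠ k → ν S = 0) (hsupp : ∀ S, μ S = 0 → ν S = 0) (m : ℕ) :
    (m + 1 : ℝ) * levelEnt n ν μ (m + 1)
      ≤ (k.choose m : ℝ) * klDiv n ν μ + ((k : ℝ) - m - 1) * levelEnt n ν μ m := by
  have h := sum_le_sum fun T (_ : T ∈ powersetCard m univ) =>
    sum_upMass_insert_mul_log_le hμ0 hμk hlc hν0 hνk hsupp T
  rw [sum_powersetCard_sum_insert
      (fun U => upMass n ν U * Real.log (upMass n ν U / upMass n μ U)), sum_add_distrib,
    sum_powersetCard_sum_superset (k := k) (f := fun S => ν S * Real.log (ν S / μ S))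
      (fun S hS => by rw [hνk S hS, zero_mul]), ← klDiv_eq_sum] at h
  refine h.trans_eq (congrArg _ ?_)
  rw [levelEnt, mul_sum]
  refine sum_congr rfl fun T hT => ?_
  rw [(mem_powersetCard.1 hT).2]

lemma klDiv_downOp (hμk : ∀ S, S.card ≠ k → μ S = 0) (hνk : ∀ S, S.card ≠ k → ν S = 0) {l : ℕ}
    (hlk : l ≤ k) :
    klDiv n (downOp n k l ν) (downOp n k l μ) = levelEnt n ν μ l / (k.choose l : ℝ) := by
  have hc : (1 / (k.choose l : ℝ)) ≠ 0 :=
    one_div_ne_zero (Nat.cast_ne_zero.2 (Nat.choose_pos hlk).ne')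
  have hfil : powersetCard l (univ : Finset (Fin n)) = univ.filter (fun T => T.card = l) := by
    ext T
    simp
  rw [klDiv_eq_sum, levelEnt, sum_div, hfil, sum_filter]
  refine sum_congr rfl fun T _ => ?_
  rw [downOp_eq hμk, downOp_eq hνk]
  split_ifs with h
  · rw [mul_div_mul_left _ _ hc]
    ring
  · simp

lemma levelEnt_zero (hμ : ∑ S, μ S = 1) (hν : ∑ S, ν S = 1) : levelEnt n ν μ 0 = 0 := by
  simp [levelEnt, upMass, hμ, hν]

lemma levelEnt_le (hk : 1 ≤ k) (hμ : IsProbDistOn n k μ)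
    (hlc : IsLogConcaveOn n (genPoly n k μ)) (hν : IsProbDistOn n k ν)
    (hsupp : ∀ S, μ S = 0 → ν S = 0) (m : ℕ) (hm : m ≤ k) :
    levelEnt n ν μ m ≤ (k.choose m : ℝ) * ((m : ℝ) / k * klDiv n ν μ) := by
  induction m with
  | zero => simp [levelEnt_zero hμ.2.2 hν.2.2]
  | succ m ih =>
    have hstep := levelEnt_step hμ.1 hμ.2.1 hlc hν.1 hν.2.1 hsupp m
    have hmk : (m : ℝ) + 1 ≤ k := by exact_mod_cast hm
    have hk0 : (0 : ℝ) < k := by exact_mod_cast hk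
    have h1 := mul_le_mul_of_nonneg_left (ih (by omega))
      (show (0 : ℝ) ≤ (k : ℝ) - m - 1 by linarith)
    have hch : (k.choose (m + 1) : ℝ) * (m + 1) = k.choose m * ((k : ℝ) - m) := by
      have := Nat.choose_succ_right_eq k m
      rw [← Nat.cast_sub (by omega)]
      exact_mod_cast this
    refine le_of_mul_le_mul_left (a := (m + 1 : ℝ)) ?_ (by positivity)
    refine (hstep.trans (add_le_add_right h1 _)).trans_eq ?_
    calc _ = (k.choose m * ((k : ℝ) - m)) * ((m + 1 : ℝ) / k * klDiv n ν μ) := by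
          field_simp
          ring
      _ = _ := by
          rw [← hch]
          push_cast
          ring

end Contraction

theorem kl_divergence_contraction
    (n k : ℕ) (hk : 1 ≤ k) (hkn : k ≤ n)
    (μ : Finset (Fin n) → ℝ) (hμ : IsProbDistOn n k μ)
    (hlc : IsLogConcaveOn n (genPoly n k μ))
    (ν : Finset (Fin n) → ℝ) (hν : IsProbDistOn n k ν)
    (hsupp : ∀ S, μ S = 0 → ν S = 0)
    (l : ℕ) (hl : 1 ≤ l) (hlk : l ≤ k) :
    klDiv n (downOp n k l ν) (downOp n k l μ)
      ≤ ((l : ℝ) / (k : ℝ)) * klDiv n ν μ := by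
  rw [klDiv_downOp hμ.2.1 hν.2.1 hlk,
    div_le_iff₀' (Nat.cast_pos.2 (Nat.choose_pos hlk))]
  exact levelEnt_le hk hμ hlc hν hsupp l hlk
end
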